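/- (Completeness Theorem) For every interpretation I, mechanism γ, and e-predicates P, Q: if I ⊨ {P}γ{Q}, then I ⊢ {P}γ{Q} (the assertion is derivable in the Hoare-style calculus for mechanisms). -/

import Mathlib

open scoped Classical

noncomputable section

namespace MPL

/-- Terms over variables `V` and function symbols `F` (function symbols applied to
a stream of arguments; finite arities are modelled by ignoring superfluous arguments). -/
inductive Term (V F : Type) : Type where
  | var : V → Term V F
  | app : F → (ℕ → Term V F) → Term V F

/-- Boolean expressions over variables `V`, function symbols `F` and relation symbols `R`. -/
inductive BExp (V F R : Type) : Type where
  | tt : BExp V F R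
  | rel : R → (ℕ → Term V F) → BExp V F R
  | not : BExp V F R → BExp V F R
  | and : BExp V F R → BExp V F R → BExp V F R

/-- MPL mechanisms: assignment, sequential composition, conditional, while-loop,
and simultaneous choice `ch_A(X)` for a finite nonempty set `A` of agents with
distinct choice variables `X a` for `a ∈ A`. -/
inductive Mech (Ag V F R : Type) : Type where
  | assign : V → Term V F → Mech Ag V F R
  | seq : Mech Ag V F R → Mech Ag V F R → Mech Ag V F R
  | ite : BExp V F R → Mech Ag V F R → Mech Ag V F R → Mech Ag V F R
  | wh : BExp V F R → Mech Ag V F R → Mech Ag V F R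
  | choice : (A : Finset Ag) → A.Nonempty → (X : Ag → V) → Set.InjOn X ↑A → Mech Ag V F R

/-- An interpretation: a domain, interpretations of the function and relation symbols,
and for every agent a preference preorder on the domain with a uniformly worst element. -/
structure Interp (Ag V F R : Type) : Type 1 where
  D : Type
  funI : F → (ℕ → D) → D
  relI : R → (ℕ → D) → Prop
  /-- `pref a d d'` means `d ≥_a d'`. -/
  pref : Ag → D → D → Prop
  pref_refl : ∀ a d, pref a d d
  pref_trans : ∀ a d1 d2 d3, pref a d1 d2 → pref a d2 d3 → pref a d1 d3
  worst : D
  worst_least : ∀ a d, pref a d worst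

variable {Ag V F R : Type}

/-- A state assigns a domain element to every mechanism variable. -/
abbrev State (I : Interp Ag V F R) : Type := V → I.D

/-- Value of a term in an interpretation at a state. -/
def Term.eval (I : Interp Ag V F R) (s : State I) : Term V F → I.D
  | .var x => s x
  | .app f ts => I.funI f (fun n => (ts n).eval I s)

/-- Truth of a boolean expression in an interpretation at a state. -/
def BExp.holds (I : Interp Ag V F R) (s : State I) : BExp V F R → Prop
  | .tt => True
  | .rel r ts => I.relI r (fun n => (ts n).eval I s)
  | .not b => ¬ b.holds I s
  | .and b1 b2 => b1.holds I s ∧ b2.holds I s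

/-- A configuration: a mechanism (or `none` for the empty mechanism Λ) together with a state. -/
abbrev Cfg (I : Interp Ag V F R) : Type := Option (Mech Ag V F R) × State I

/-- Update a state at one variable. -/
def updState (I : Interp Ag V F R) (s : State I) (x : V) (d : I.D) : State I :=
  fun y => if y = x then d else s y

/-- The structured operational semantics: labelled transitions `⟨γ,s⟩ →_A ⟨γ',s'⟩`. -/
inductive Step (I : Interp Ag V F R) : Cfg I → Set Ag → Cfg I → Prop where
  | assign (x : V) (t : Term V F) (s : State I) :
      Step I (some (.assign x t), s) ∅ (none, updState I s x (t.eval I s))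
  | choice (A : Finset Ag) (hA : A.Nonempty) (X : Ag → V) (hX : Set.InjOn X ↑A)
      (s s' : State I) (hagree : ∀ y : V, (∀ a ∈ A, X a ≠ y) → s' y = s y) :
      Step I (some (.choice A hA X hX), s) ↑A (none, s')
  | seqFin {γ1 γ2 s L s'} : Step I (some γ1, s) L (none, s') →
      Step I (some (.seq γ1 γ2), s) L (some γ2, s')
  | seqStep {γ1 γ2 s L γ1' s'} : Step I (some γ1, s) L (some γ1', s') →
      Step I (some (.seq γ1 γ2), s) L (some (.seq γ1' γ2), s')
  | iteT {B γ1 γ2 s} : B.holds I s → Step I (some (.ite B γ1 γ2), s) ∅ (some γ1, s)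
  | iteF {B γ1 γ2 s} : ¬ B.holds I s → Step I (some (.ite B γ1 γ2), s) ∅ (some γ2, s)
  | whF {B γ s} : ¬ B.holds I s → Step I (some (.wh B γ), s) ∅ (none, s)
  | whT {B γ s} : B.holds I s → Step I (some (.wh B γ), s) ∅ (some (.seq γ (.wh B γ)), s)

/-- A (partial) history of the game rooted at `c0`: a nonempty finite sequence of
configurations starting at `c0` and linked by transitions. -/
def IsHist (I : Interp Ag V F R) (c0 : Cfg I) (h : List (Cfg I)) : Prop :=
  h.head? = some c0 ∧ h.Chain' (fun c c' => ∃ L, Step I c L c')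

/-- A strategy profile: for every agent a strategy assigning a chosen value to each history. -/
abbrev Profile (I : Interp Ag V F R) : Type := Ag → List (Cfg I) → I.D

/-- The state resulting from the agents in `A` choosing values for their variables
`X a` according to the profile `σ` at history `h`. -/
def chooseVal (I : Interp Ag V F R) (A : Finset Ag) (X : Ag → V) (σ : Profile I)
    (h : List (Cfg I)) (s : State I) : State I :=
  fun y => if hy : ∃ a, a ∈ A ∧ X a = y then σ hy.choose h else s y

/-- The successor configuration of a (non-empty) configuration, as determined by the
operational semantics together with the choices prescribed by the profile `σ` at history `h`. -/
def next (I : Interp Ag V F R) (σ : Profile I) (h : List (Cfg I)) :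
    Mech Ag V F R → State I → Cfg I
  | .assign x t, s => (none, updState I s x (t.eval I s))
  | .choice A _ X _, s => (none, chooseVal I A X σ h s)
  | .seq γ1 γ2, s =>
      match next I σ h γ1 s with
      | (none, s') => (some γ2, s')
      | (some γ1', s') => (some (.seq γ1' γ2), s')
  | .ite B γ1 γ2, s => if B.holds I s then (some γ1, s) else (some γ2, s)
  | .wh B γ, s => if B.holds I s then (some (.seq γ (.wh B γ)), s) else (none, s)

/-- Extend a history by one step of play according to `σ` (histories ending in Λ stay put). -/
def extend (I : Interp Ag V F R) (σ : Profile I) (h : List (Cfg I)) : List (Cfg I) :=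
  match h.getLast? with
  | some (some γ, s) => h ++ [next I σ h γ s]
  | _ => h

/-- The history of the unique run determined by profile `σ` from `c0`, after `n` steps. -/
def runH (I : Interp Ag V F R) (c0 : Cfg I) (σ : Profile I) : ℕ → List (Cfg I)
  | 0 => [c0]
  | n + 1 => extend I σ (runH I c0 σ n)

/-- A run: the (possibly infinite) sequence of configurations of a maximal play. -/
abbrev Run (I : Interp Ag V F R) : Type := ℕ → Option (Cfg I)

/-- The unique maximal run determined by profile `σ` from initial configuration `c0`. -/
def runOf (I : Interp Ag V F R) (c0 : Cfg I) (σ : Profile I) : Run I :=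
  fun n => (runH I c0 σ n)[n]?

/-- `run(σ)` is finite (reaches the empty mechanism Λ). -/
def Terminates (I : Interp Ag V F R) (c0 : Cfg I) (σ : Profile I) : Prop :=
  ∃ n, ∃ s : State I, (runH I c0 σ n).getLast? = some ((none : Option (Mech Ag V F R)), s)

/-- The final state `s_σ` of a finite run. -/
def finalState (I : Interp Ag V F R) {c0 : Cfg I} {σ : Profile I}
    (h : Terminates I c0 σ) : State I :=
  h.choose_spec.choose

/-- An outcome function assigns an element of the domain to every terminal history
(represented by the corresponding run). -/
abbrev OutcomeF (I : Interp Ag V F R) : Type := Run I → I.D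

/-- An extended predicate (e-predicate): a set of pairs (state, outcome). -/
abbrev EPred (I : Interp Ag V F R) : Type := Set (State I × I.D)

/-- `ô ∈ Ô_Q`: every finite run is assigned an outcome satisfying `Q` at its final state. -/
def memOhat (I : Interp Ag V F R) (c0 : Cfg I) (Q : EPred I) (oh : OutcomeF I) : Prop :=
  ∀ σ : Profile I, ∀ ht : Terminates I c0 σ, (finalState I ht, oh (runOf I c0 σ)) ∈ Q

/-- `σ` is a Nash equilibrium in the game rooted at `c0` with outcome function `oh`. -/
def NashEq (I : Interp Ag V F R) (c0 : Cfg I) (oh : OutcomeF I) (σ : Profile I) : Prop :=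
  ∀ (i : Ag) (τ : Profile I), (∀ j, j ≠ i → τ j = σ j) →
    I.pref i (oh (runOf I c0 σ)) (oh (runOf I c0 τ))

/-- Prepend a finite sequence of configurations to a run. -/
def prependRun (I : Interp Ag V F R) (l : List (Cfg I)) (ρ : Run I) : Run I :=
  fun n => if hn : n < l.length then some l[n] else ρ (n - l.length)

/-- Restriction of an outcome function to the subgame reached via history `h`. -/
def restrictO (I : Interp Ag V F R) (h : List (Cfg I)) (oh : OutcomeF I) : OutcomeF I :=
  fun ρ => oh (prependRun I h.dropLast ρ)

/-- Restriction of a strategy profile to the subgame reached via history `h`. -/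
def restrictP (I : Interp Ag V F R) (h : List (Cfg I)) (σ : Profile I) : Profile I :=
  fun a h' => σ a (h.dropLast ++ h')

/-- `σ` is a subgame-perfect equilibrium in `G(γ,s,I,oh)`: its restriction to every
subgame (rooted at any configuration reachable from `⟨γ,s⟩`) is a Nash equilibrium there. -/
def SPE (I : Interp Ag V F R) (γ : Mech Ag V F R) (s : State I)
    (oh : OutcomeF I) (σ : Profile I) : Prop :=
  ∀ (h : List (Cfg I)) (c : Cfg I), IsHist I (some γ, s) h → h.getLast? = some c →
    NashEq I c (restrictO I h oh) (restrictP I h σ)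

/-- The correctness assertion `I ⊨ {P} γ {Q}`. -/
def Valid (I : Interp Ag V F R) (P : EPred I) (γ : Mech Ag V F R) (Q : EPred I) : Prop :=
  ∀ so ∈ P, ∃ (oh : OutcomeF I) (σ : Profile I),
    memOhat I (some γ, so.1) Q oh ∧ SPE I γ so.1 oh σ ∧ oh (runOf I (some γ, so.1) σ) = so.2

/-- The weakest precondition `wpre(γ,Q,I)`. -/
def wpre (I : Interp Ag V F R) (γ : Mech Ag V F R) (Q : EPred I) : EPred I :=
  {so | ∃ (oh : OutcomeF I) (σ : Profile I),
    memOhat I (some γ, so.1) Q oh ∧ SPE I γ so.1 oh σ ∧ oh (runOf I (some γ, so.1) σ) = so.2}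

/-- The substituted e-predicate `Q[x/t]`. -/
def substPred (I : Interp Ag V F R) (Q : EPred I) (x : V) (t : Term V F) : EPred I :=
  {so | (updState I so.1 x (t.eval I so.1), so.2) ∈ Q}

/-- `B^I ∩ P`. -/
def gate (I : Interp Ag V F R) (B : BExp V F R) (P : EPred I) : EPred I :=
  {so | so ∈ P ∧ B.holds I so.1}

/-- `(¬B)^I ∩ P`. -/
def gateN (I : Interp Ag V F R) (B : BExp V F R) (P : EPred I) : EPred I :=
  {so | so ∈ P ∧ ¬ B.holds I so.1}

/-- The Hoare-style calculus for mechanisms: `I ⊢ {P} γ {Q}`. -/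
inductive Deriv (I : Interp Ag V F R) : EPred I → Mech Ag V F R → EPred I → Prop where
  | assign (Q : EPred I) (x : V) (t : Term V F) :
      Deriv I (substPred I Q x t) (.assign x t) Q
  | choice (A : Finset Ag) (hA : A.Nonempty) (X : Ag → V) (hX : Set.InjOn X ↑A)
      (Q : EPred I) :
      Deriv I (wpre I (.choice A hA X hX) Q) (.choice A hA X hX) Q
  | comp {P R' Q : EPred I} {γ1 γ2 : Mech Ag V F R} :
      Deriv I P γ1 R' → Deriv I R' γ2 Q → Deriv I P (.seq γ1 γ2) Q
  | ifR {P Q : EPred I} {B : BExp V F R} {γ1 γ2 : Mech Ag V F R} :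
      Deriv I (gate I B P) γ1 Q → Deriv I (gateN I B P) γ2 Q →
      Deriv I P (.ite B γ1 γ2) Q
  | whileR {P : EPred I} {B : BExp V F R} {γ : Mech Ag V F R} :
      Deriv I (gate I B P) γ P → Deriv I P (.wh B γ) (gateN I B P)
  | conseq {P P' Q Q' : EPred I} {γ : Mech Ag V F R} :
      P ⊆ P' → Deriv I P' γ Q' → Q' ⊆ Q → Deriv I P γ Q

/-- The Nash-equilibrium variant of validity. -/
def NashValid (I : Interp Ag V F R) (P : EPred I) (γ : Mech Ag V F R) (Q : EPred I) : Prop :=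
  ∀ so ∈ P, ∃ (oh : OutcomeF I) (σ : Profile I),
    memOhat I (some γ, so.1) Q oh ∧ NashEq I (some γ, so.1) oh σ ∧
    oh (runOf I (some γ, so.1) σ) = so.2

/-- Mechanisms without any `ch_A` construct, i.e. ordinary programs (MPL(PRG)). -/
def ChoiceFree : Mech Ag V F R → Prop
  | .assign _ _ => True
  | .seq γ1 γ2 => ChoiceFree γ1 ∧ ChoiceFree γ2
  | .ite _ γ1 γ2 => ChoiceFree γ1 ∧ ChoiceFree γ2
  | .wh _ γ => ChoiceFree γ
  | .choice _ _ _ _ => False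

/-- Standard Hoare partial correctness: every finite maximal execution of `γ`
from a state in `P` terminates in a state in `Q`. -/
def HoarePartial (I : Interp Ag V F R) (P : Set (State I)) (γ : Mech Ag V F R)
    (Q : Set (State I)) : Prop :=
  ∀ s ∈ P, ∀ (h : List (Cfg I)) (t : State I),
    IsHist I (some γ, s) h → h.getLast? = some ((none : Option (Mech Ag V F R)), t) → t ∈ Q

end MPL

namespace MPL

/-- One transition of the operational semantics, with its label forgotten. -/
def Trans (I : Interp Ag V F R) (c c' : Cfg I) : Prop := ∃ L, Step I c L c'

/-- The run traced by a single history. -/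
def listRun (I : Interp Ag V F R) (H : List (Cfg I)) : Run I := fun n => H[n]?

/-- The maximal run obtained by playing `σ` from the history `H` on. -/
def runFrom (I : Interp Ag V F R) (σ : Profile I) (H : List (Cfg I)) : Run I :=
  fun n => ((extend I σ)^[n] H)[n]?

variable {I : Interp Ag V F R}

theorem isHist_iff {c0 : Cfg I} {h : List (Cfg I)} :
    IsHist I c0 h ↔ h.head? = some c0 ∧ h.IsChain (Trans I) := Iff.rfl

theorem isHist_singleton (c0 : Cfg I) : IsHist I c0 [c0] :=
  isHist_iff.2 ⟨rfl, List.isChain_singleton _⟩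

theorem IsHist.snoc {c0 c c' : Cfg I} {L : List (Cfg I)} (h : IsHist I c0 (L ++ [c]))
    (hc : Trans I c c') : IsHist I c0 (L ++ [c] ++ [c']) := by
  rw [isHist_iff] at h ⊢
  refine ⟨by cases L <;> simpa using h.1, ?_⟩
  rw [List.isChain_append]
  exact ⟨h.2, List.isChain_singleton _, by simpa using hc⟩

theorem IsHist.append {c0 c : Cfg I} {L H : List (Cfg I)} (h : IsHist I c0 (L ++ [c]))
    (h' : IsHist I c H) : IsHist I c0 (L ++ H) := by
  rw [isHist_iff] at h h' ⊢
  cases H with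
  | nil => simp at h'
  | cons a H =>
    obtain ⟨h1, h2⟩ := h'
    simp only [List.head?_cons, Option.some.injEq] at h1
    subst h1
    refine ⟨by cases L <;> simpa using h.1, ?_⟩
    rw [List.isChain_split]
    exact ⟨h.2, h2⟩

theorem IsHist.ne_nil {c0 : Cfg I} {H : List (Cfg I)} (h : IsHist I c0 H) : H ≠ [] := by
  rintro rfl
  simp [isHist_iff] at h

theorem not_trans_none {s : State I} {c : Cfg I} : ¬ Trans I (none, s) c := by
  rintro ⟨L, h⟩
  cases h

theorem isChain_dropLast_ne_none {L : List (Cfg I)} {c : Cfg I}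
    (h : (L ++ [c]).IsChain (Trans I)) : ∀ d ∈ L, d.1 ≠ none := by
  induction L with
  | nil => simp
  | cons a L ih =>
    intro d hd
    rcases List.mem_cons.1 hd with rfl | hd
    · intro hn
      obtain ⟨d1, d2⟩ := d
      cases hn
      cases L with
      | nil => exact not_trans_none (List.isChain_cons_cons.1 h).1
      | cons b L => exact not_trans_none (List.isChain_cons_cons.1 h).1
    · exact ih (List.IsChain.of_cons h) d hd

theorem next_congr {σ τ : Profile I} {h h' : List (Cfg I)} (hst : ∀ a, σ a h = τ a h')
    (γ : Mech Ag V F R) (s : State I) : next I σ h γ s = next I τ h' γ s := by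
  induction γ generalizing s with
  | seq γ1 γ2 ih1 ih2 => simp only [next, ih1]
  | choice A hA X hX =>
    simp only [next, Prod.mk.injEq, true_and]
    funext y
    simp only [chooseVal, hst]
  | _ => rfl

theorem trans_next (σ : Profile I) (h : List (Cfg I)) (γ : Mech Ag V F R) (s : State I) :
    Trans I (some γ, s) (next I σ h γ s) := by
  induction γ generalizing s with
  | assign x t => exact ⟨_, Step.assign x t s⟩
  | seq γ1 γ2 ih1 ih2 =>
    obtain ⟨L, hL⟩ := ih1 s
    simp only [next]
    rcases hn : next I σ h γ1 s with ⟨_ | γ1', s'⟩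
    · rw [hn] at hL
      exact ⟨L, Step.seqFin hL⟩
    · rw [hn] at hL
      exact ⟨L, Step.seqStep hL⟩
  | ite B γ1 γ2 ih1 ih2 =>
    by_cases hB : B.holds I s
    · simp only [next, if_pos hB]
      exact ⟨_, Step.iteT hB⟩
    · simp only [next, if_neg hB]
      exact ⟨_, Step.iteF hB⟩
  | wh B γ ih =>
    by_cases hB : B.holds I s
    · simp only [next, if_pos hB]
      exact ⟨_, Step.whT hB⟩
    · simp only [next, if_neg hB]
      exact ⟨_, Step.whF hB⟩
  | choice A hA X hX =>
    refine ⟨_, Step.choice A hA X hX s _ fun y hy => ?_⟩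
    simp only [chooseVal]
    rw [dif_neg]
    rintro ⟨a, ha, hX⟩
    exact hy a ha hX

theorem exists_choices_of_step {c c' : Cfg I} {L : Set Ag} (h : Step I c L c') :
    ∀ γ, c.1 = some γ → ∃ v : Ag → I.D, ∀ (σ : Profile I) (g : List (Cfg I)),
      (∀ a, σ a g = v a) → next I σ g γ c.2 = c' := by
  induction h with
  | assign x t s =>
    rintro γ ⟨⟩
    exact ⟨fun _ => I.worst, fun σ g _ => rfl⟩
  | choice A hA X hX s s' hagree =>
    rintro γ ⟨⟩
    refine ⟨fun a => s' (X a), fun σ g hσ => ?_⟩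
    simp only [next, Prod.mk.injEq, true_and]
    funext y
    simp only [chooseVal]
    split_ifs with hy
    · exact (hσ _).trans (congrArg s' hy.choose_spec.2)
    · exact (hagree y fun a ha hX => hy ⟨a, ha, hX⟩).symm
  | seqFin _ ih =>
    rintro γ ⟨⟩
    obtain ⟨v, hv⟩ := ih _ rfl
    exact ⟨v, fun σ g hσ => by simp only [next, hv σ g hσ]⟩
  | seqStep _ ih =>
    rintro γ ⟨⟩
    obtain ⟨v, hv⟩ := ih _ rfl
    exact ⟨v, fun σ g hσ => by simp only [next, hv σ g hσ]⟩
  | iteT hB =>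
    rintro γ ⟨⟩
    exact ⟨fun _ => I.worst, fun σ g _ => by simp only [next, if_pos hB]⟩
  | iteF hB =>
    rintro γ ⟨⟩
    exact ⟨fun _ => I.worst, fun σ g _ => by simp only [next, if_neg hB]⟩
  | whF hB =>
    rintro γ ⟨⟩
    exact ⟨fun _ => I.worst, fun σ g _ => by simp only [next, if_neg hB]⟩
  | whT hB =>
    rintro γ ⟨⟩
    exact ⟨fun _ => I.worst, fun σ g _ => by simp only [next, if_pos hB]⟩

theorem extend_snoc_some (σ : Profile I) (L : List (Cfg I)) (γ : Mech Ag V F R) (s : State I) :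
    extend I σ (L ++ [(some γ, s)]) =
      L ++ [(some γ, s)] ++ [next I σ (L ++ [(some γ, s)]) γ s] := by
  simp [extend]

theorem extend_snoc_none (σ : Profile I) (L : List (Cfg I)) (s : State I) :
    extend I σ (L ++ [(none, s)]) = L ++ [(none, s)] := by
  simp [extend]

theorem extend_ne_nil (σ : Profile I) {L : List (Cfg I)} (hL : L ≠ []) :
    extend I σ L ≠ [] := by
  rcases List.eq_nil_or_concat' L with rfl | ⟨L, ⟨_ | γ, s⟩, rfl⟩
  · exact absurd rfl hL
  · rw [extend_snoc_none]; simp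
  · rw [extend_snoc_some]; simp

theorem iterate_extend_ne_nil (σ : Profile I) {L : List (Cfg I)} (hL : L ≠ []) (n : ℕ) :
    (extend I σ)^[n] L ≠ [] := by
  induction n generalizing L with
  | zero => exact hL
  | succ n ih => exact ih (extend_ne_nil σ hL)

theorem IsHist.extend {c0 : Cfg I} {H : List (Cfg I)} (h : IsHist I c0 H) (σ : Profile I) :
    IsHist I c0 (extend I σ H) := by
  rcases List.eq_nil_or_concat' H with rfl | ⟨L, ⟨_ | γ, s⟩, rfl⟩
  · exact absurd rfl h.ne_nil
  · rwa [extend_snoc_none]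
  · rw [extend_snoc_some]
    exact h.snoc (trans_next _ _ _ _)

theorem IsHist.iterate_extend {c0 : Cfg I} {H : List (Cfg I)} (h : IsHist I c0 H)
    (σ : Profile I) (n : ℕ) : IsHist I c0 ((MPL.extend I σ)^[n] H) := by
  induction n generalizing H with
  | zero => exact h
  | succ n ih => exact ih (h.extend σ)

theorem iterate_extend_none (σ : Profile I) (L : List (Cfg I)) (s : State I) (n : ℕ) :
    (extend I σ)^[n] (L ++ [(none, s)]) = L ++ [(none, s)] :=
  Function.iterate_fixed (extend_snoc_none σ L s) n

/-- Histories only grow, and play through a nonterminated history adds one configuration. -/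
theorem lt_length_or_fixed (σ : Profile I) {H : List (Cfg I)} (hH : H ≠ []) (n : ℕ) :
    n < ((extend I σ)^[n] H).length ∨
      extend I σ ((extend I σ)^[n] H) = (extend I σ)^[n] H := by
  induction n with
  | zero => exact Or.inl (List.length_pos_iff.2 hH)
  | succ n ih =>
    rw [Function.iterate_succ_apply']
    rcases ih with ih | ih
    · generalize (extend I σ)^[n] H = G at ih
      rcases List.eq_nil_or_concat' G with rfl | ⟨L, ⟨_ | γ, s⟩, rfl⟩
      · simp at ih
      · right; simp only [extend_snoc_none]
      · left
        rw [extend_snoc_some]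
        simpa using ih
    · right; rw [ih, ih]

theorem getElem?_extend (σ : Profile I) (L : List (Cfg I)) {n : ℕ}
    (h : n < L.length ∨ extend I σ L = L) : (extend I σ L)[n]? = L[n]? := by
  rcases h with h | h
  · rcases List.eq_nil_or_concat' L with rfl | ⟨L, ⟨_ | γ, s⟩, rfl⟩
    · simp at h
    · rw [extend_snoc_none]
    · rw [extend_snoc_some, List.getElem?_append_left h]
  · rw [h]

theorem runFrom_extend (σ : Profile I) {H : List (Cfg I)} (hH : H ≠ []) :
    runFrom I σ (extend I σ H) = runFrom I σ H := by
  funext n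
  simp only [runFrom]
  rw [← Function.iterate_succ_apply, Function.iterate_succ_apply',
    getElem?_extend σ _ (lt_length_or_fixed σ hH n)]

theorem runFrom_iterate (σ : Profile I) {H : List (Cfg I)} (hH : H ≠ []) (n : ℕ) :
    runFrom I σ ((extend I σ)^[n] H) = runFrom I σ H := by
  induction n with
  | zero => rfl
  | succ n ih =>
    rw [Function.iterate_succ_apply', runFrom_extend σ (iterate_extend_ne_nil σ hH n), ih]

theorem runFrom_none (σ : Profile I) (L : List (Cfg I)) (s : State I) :
    runFrom I σ (L ++ [(none, s)]) = listRun I (L ++ [(none, s)]) := by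
  funext n
  simp only [runFrom, listRun, iterate_extend_none]

theorem extend_congr {σ τ : Profile I} {H : List (Cfg I)} (h : ∀ a, σ a H = τ a H) :
    extend I σ H = extend I τ H := by
  rcases List.eq_nil_or_concat' H with rfl | ⟨L, ⟨_ | γ, s⟩, rfl⟩
  · rfl
  · simp only [extend_snoc_none]
  · simp only [extend_snoc_some, next_congr h]

theorem exists_extend_eq_append (σ : Profile I) (H : List (Cfg I)) :
    ∃ G, extend I σ H = H ++ G := by
  rcases List.eq_nil_or_concat' H with rfl | ⟨L, ⟨_ | γ, s⟩, rfl⟩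
  · exact ⟨[], rfl⟩
  · exact ⟨[], by rw [extend_snoc_none, List.append_nil]⟩
  · exact ⟨_, extend_snoc_some _ _ _ _⟩

theorem runFrom_congr {σ τ : Profile I} {H : List (Cfg I)}
    (h : ∀ a G, σ a (H ++ G) = τ a (H ++ G)) : runFrom I σ H = runFrom I τ H := by
  have key : ∀ n, ∃ G, (extend I σ)^[n] H = H ++ G ∧ (extend I τ)^[n] H = H ++ G := by
    intro n
    induction n with
    | zero => exact ⟨[], by simp⟩
    | succ n ih =>
      obtain ⟨G, h1, h2⟩ := ih
      obtain ⟨G', hG'⟩ := exists_extend_eq_append σ (H ++ G)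
      refine ⟨G ++ G', ?_, ?_⟩
      · rw [Function.iterate_succ_apply', h1, hG', List.append_assoc]
      · rw [Function.iterate_succ_apply', h2, ← extend_congr fun a => h a G, hG',
          List.append_assoc]
  funext n
  obtain ⟨G, h1, h2⟩ := key n
  simp only [runFrom, h1, h2]

theorem runH_eq (c0 : Cfg I) (σ : Profile I) (n : ℕ) :
    runH I c0 σ n = (extend I σ)^[n] [c0] := by
  induction n with
  | zero => rfl
  | succ n ih => rw [Function.iterate_succ_apply', ← ih]; rfl

theorem runOf_eq (c0 : Cfg I) (σ : Profile I) : runOf I c0 σ = runFrom I σ [c0] := by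
  funext n
  simp only [runOf, runFrom, runH_eq]

theorem extend_append (σ : Profile I) (D : List (Cfg I)) {L : List (Cfg I)} (hL : L ≠ []) :
    extend I σ (D ++ L) = D ++ extend I (fun a g => σ a (D ++ g)) L := by
  rcases List.eq_nil_or_concat' L with rfl | ⟨L, ⟨_ | γ, s⟩, rfl⟩
  · exact absurd rfl hL
  · rw [extend_snoc_none, ← List.append_assoc, extend_snoc_none]
  · rw [extend_snoc_some, ← List.append_assoc, extend_snoc_some]
    rw [next_congr (σ := σ) (τ := fun a g => σ a (D ++ g)) (h' := L ++ [(some γ, s)])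
      (fun a => by rw [List.append_assoc]) γ s]
    simp only [List.append_assoc]

theorem iterate_extend_append (σ : Profile I) (D : List (Cfg I)) {L : List (Cfg I)}
    (hL : L ≠ []) (n : ℕ) :
    (extend I σ)^[n] (D ++ L) = D ++ (extend I (fun a g => σ a (D ++ g)))^[n] L := by
  induction n generalizing L with
  | zero => rfl
  | succ n ih =>
    rw [Function.iterate_succ_apply, extend_append σ D hL, ih (extend_ne_nil _ hL),
      Function.iterate_succ_apply]

theorem getElem?_iterate_extend (σ : Profile I) {H : List (Cfg I)} (hH : H ≠ []) (n k : ℕ) :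
    ((extend I σ)^[n + k] H)[n]? = ((extend I σ)^[n] H)[n]? := by
  have := congrFun (runFrom_iterate σ hH k) n
  simp only [runFrom] at this
  rwa [← Function.iterate_add_apply] at this

theorem prependRun_runFrom (σ : Profile I) (D : List (Cfg I)) {L : List (Cfg I)} (hL : L ≠ []) :
    prependRun I D (runFrom I (fun a g => σ a (D ++ g)) L) = runFrom I σ (D ++ L) := by
  funext n
  simp only [prependRun, runFrom]
  rw [iterate_extend_append σ D hL]
  split_ifs with h
  · rw [List.getElem?_append_left h, List.getElem?_eq_getElem h]
  · rw [List.getElem?_append_right (not_lt.1 h)]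
    obtain ⟨m, rfl⟩ := Nat.exists_eq_add_of_le (not_lt.1 h)
    rw [Nat.add_sub_cancel_left, Nat.add_comm D.length m, getElem?_iterate_extend _ hL]

theorem prependRun_listRun (D L : List (Cfg I)) :
    prependRun I D (listRun I L) = listRun I (D ++ L) := by
  funext n
  simp only [prependRun, listRun]
  split_ifs with h
  · rw [List.getElem?_append_left h, List.getElem?_eq_getElem h]
  · rw [List.getElem?_append_right (not_lt.1 h)]

theorem listRun_injective {G H : List (Cfg I)} (h : listRun I G = listRun I H) : G = H :=
  List.ext_getElem? fun n => congrFun h n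

/-- Every history is played by some profile. -/
theorem exists_profile_of_isHist {c0 : Cfg I} {H : List (Cfg I)} (h : IsHist I c0 H) :
    ∃ σ : Profile I, (extend I σ)^[H.length - 1] [c0] = H := by
  rw [isHist_iff] at h
  have hstep : ∀ k, ∃ v : Ag → I.D, ∀ hk : k + 1 < H.length, ∀ (σ : Profile I),
      (∀ a, σ a (H.take (k + 1)) = v a) → extend I σ (H.take (k + 1)) = H.take (k + 2) := by
    intro k
    by_cases hk : k + 1 < H.length
    · obtain ⟨L, hL⟩ := h.2.getElem k hk
      rcases hc : H[k] with ⟨_ | γ, s⟩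
      · rw [hc] at hL
        exact absurd ⟨L, hL⟩ not_trans_none
      · obtain ⟨v, hv⟩ := exists_choices_of_step hL γ (by rw [hc])
        refine ⟨v, fun _ σ hσ => ?_⟩
        have h1 : H.take (k + 1) = H.take k ++ [(some γ, s)] := by
          rw [List.take_succ_eq_append_getElem (by omega), hc]
        have h2 := hv σ _ hσ
        rw [hc] at h2
        rw [List.take_succ_eq_append_getElem hk, ← h2, h1, extend_snoc_some]
    · exact ⟨fun _ => I.worst, fun hk' => absurd hk' hk⟩
  choose v hv using hstep
  let σ : Profile I := fun a g => v (g.length - 1) a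
  have key : ∀ n, n < H.length → (extend I σ)^[n] [c0] = H.take (n + 1) := by
    intro n
    induction n with
    | zero =>
      intro _
      cases H with
      | nil => simp at h
      | cons a H => simpa using h.1.symm
    | succ n ih =>
      intro hn
      rw [Function.iterate_succ_apply', ih (by omega)]
      refine hv n hn σ fun a => ?_
      simp only [σ, List.length_take]
      congr 1
      omega
  have hpos : 0 < H.length := List.length_pos_iff.2 (by rintro rfl; simp at h)
  refine ⟨σ, ?_⟩
  rw [key _ (by omega), List.take_of_length_le (by omega)]

theorem runFrom_of_iterate_eq {σ : Profile I} {c0 : Cfg I} {n : ℕ} {L : List (Cfg I)}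
    {s : State I} (h : (extend I σ)^[n] [c0] = L ++ [(none, s)]) :
    runFrom I σ [c0] = listRun I (L ++ [(none, s)]) := by
  rw [← runFrom_none σ, ← h, runFrom_iterate σ (List.cons_ne_nil _ _)]

theorem finalState_spec {c0 : Cfg I} {σ : Profile I} (ht : Terminates I c0 σ) :
    ∃ n L, (extend I σ)^[n] [c0] = L ++ [(none, finalState I ht)] := by
  have h := ht.choose_spec.choose_spec
  obtain ⟨L, hL⟩ := List.getLast?_eq_some_iff.1 h
  exact ⟨_, L, (runH_eq _ _ _).symm.trans hL⟩

theorem memOhat_iff {c0 : Cfg I} {Q : EPred I} {oh : OutcomeF I} :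
    memOhat I c0 Q oh ↔ ∀ (L : List (Cfg I)) (s : State I), IsHist I c0 (L ++ [(none, s)]) →
      (s, oh (listRun I (L ++ [(none, s)]))) ∈ Q := by
  constructor
  · intro h L s hL
    obtain ⟨σ, hσ⟩ := exists_profile_of_isHist hL
    have ht : Terminates I c0 σ :=
      ⟨(L ++ [((none : Option (Mech Ag V F R)), s)]).length - 1, s, by rw [runH_eq, hσ]; simp⟩
    obtain ⟨n, L', hL'⟩ := finalState_spec ht
    have h1 := runFrom_of_iterate_eq hσ
    have h2 := listRun_injective (h1.symm.trans (runFrom_of_iterate_eq hL'))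
    have h3 := h σ ht
    rw [runOf_eq, h1] at h3
    have h4 : s = finalState I ht := by simpa using (List.append_inj' h2 rfl).2
    rwa [← h4] at h3
  · intro h σ ht
    obtain ⟨n, L, hL⟩ := finalState_spec ht
    rw [runOf_eq, runFrom_of_iterate_eq hL]
    refine h L _ ?_
    rw [← hL]
    exact (isHist_singleton c0).iterate_extend σ n

/-- `σ` is optimal against one-agent deviations from every history rooted at `c0`. -/
def PerfectAt (I : Interp Ag V F R) (c0 : Cfg I) (oh : OutcomeF I) (σ : Profile I) : Prop :=
  ∀ H, IsHist I c0 H → ∀ (i : Ag) (τ : Profile I), (∀ j, j ≠ i → τ j = σ j) →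
    I.pref i (oh (runFrom I σ H)) (oh (runFrom I τ H))

theorem exists_profile_restrict {σ : Profile I} {D : List (Cfg I)} {i : Ag} {τ : Profile I}
    (h : ∀ j, j ≠ i → τ j = fun g => σ j (D ++ g)) :
    ∃ τ' : Profile I, (∀ j, j ≠ i → τ' j = σ j) ∧ (fun a g => τ' a (D ++ g)) = τ := by
  refine ⟨fun a g => if a = i then τ i (g.drop D.length) else σ a g, fun j hj => ?_, ?_⟩
  · simp only [if_neg hj]
  · funext a g
    by_cases ha : a = i
    · subst ha; simp
    · simp only [if_neg ha, h a ha]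

theorem SPE_iff {γ : Mech Ag V F R} {s : State I} {oh : OutcomeF I} {σ : Profile I} :
    SPE I γ s oh σ ↔ PerfectAt I (some γ, s) oh σ := by
  constructor
  · intro h H hH i τ hτ
    rcases List.eq_nil_or_concat' H with rfl | ⟨D, c, rfl⟩
    · exact absurd rfl hH.ne_nil
    · have h1 := h _ c hH (by simp) i (fun a g => τ a (D ++ g))
        (fun j hj => by funext g; simp [restrictP, hτ j hj])
      simp only [restrictO, runOf_eq] at h1
      unfold restrictP at h1
      simp only [List.dropLast_concat] at h1
      rwa [prependRun_runFrom _ _ (List.cons_ne_nil _ _),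
        prependRun_runFrom _ _ (List.cons_ne_nil _ _)] at h1
  · intro h H c hH hc i τ hτ
    rw [List.getLast?_eq_some_iff] at hc
    obtain ⟨D, rfl⟩ := hc
    unfold restrictP at hτ ⊢
    simp only [List.dropLast_concat] at hτ ⊢
    obtain ⟨τ', h1, rfl⟩ := exists_profile_restrict hτ
    simp only [restrictO, runOf_eq, List.dropLast_concat]
    rw [prependRun_runFrom _ _ (List.cons_ne_nil _ _),
      prependRun_runFrom _ _ (List.cons_ne_nil _ _)]
    exact h _ hH i τ' h1

theorem mem_wpre {γ : Mech Ag V F R} {Q : EPred I} {s : State I} {o : I.D} :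
    (s, o) ∈ wpre I γ Q ↔ ∃ (oh : OutcomeF I) (σ : Profile I),
      (∀ (L : List (Cfg I)) (s' : State I), IsHist I (some γ, s) (L ++ [(none, s')]) →
        (s', oh (listRun I (L ++ [(none, s')]))) ∈ Q) ∧
      PerfectAt I (some γ, s) oh σ ∧ oh (runFrom I σ [(some γ, s)]) = o := by
  simp only [wpre, Set.mem_ofPred_eq, memOhat_iff, SPE_iff, runOf_eq]

/-- The outcome of a subgame lies in the weakest precondition of its root. -/
theorem mem_wpre_of_isHist {c0 : Cfg I} {Q : EPred I} {oh : OutcomeF I} {σ : Profile I}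
    (hQ : ∀ (L : List (Cfg I)) (s' : State I), IsHist I c0 (L ++ [(none, s')]) →
      (s', oh (listRun I (L ++ [(none, s')]))) ∈ Q)
    (hσ : PerfectAt I c0 oh σ) {D : List (Cfg I)} {γ : Mech Ag V F R} {s : State I}
    (hD : IsHist I c0 (D ++ [(some γ, s)])) :
    (s, oh (runFrom I σ (D ++ [(some γ, s)]))) ∈ wpre I γ Q := by
  rw [mem_wpre]
  refine ⟨fun ρ => oh (prependRun I D ρ), fun a g => σ a (D ++ g), fun L s' hL => ?_,
    fun H hH i τ hτ => ?_, ?_⟩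
  · simp only [prependRun_listRun]
    rw [← List.append_assoc]
    refine hQ _ _ ?_
    rw [List.append_assoc]
    exact hD.append hL
  · obtain ⟨τ', h1, rfl⟩ := exists_profile_restrict hτ
    simp only [prependRun_runFrom _ _ hH.ne_nil]
    exact hσ _ (hD.append hH) i τ' h1
  · simp only [prependRun_runFrom _ _ (List.cons_ne_nil _ _)]

/-- A configuration of `γ1`, read as a configuration of `γ1; γ2`. -/
def embed (I : Interp Ag V F R) (γ2 : Mech Ag V F R) : Cfg I → Cfg I
  | (none, s) => (some γ2, s)
  | (some γ, s) => (some (.seq γ γ2), s)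

theorem ne_seq_self (γ γ2 : Mech Ag V F R) : γ2 ≠ .seq γ γ2 := by
  intro h
  have := congrArg sizeOf h
  simp at this

theorem embed_injective (γ2 : Mech Ag V F R) : Function.Injective (embed I γ2) := by
  rintro ⟨_ | γ, s⟩ ⟨_ | γ', s'⟩ h
  · simpa [embed] using h
  · simp only [embed, Prod.mk.injEq, Option.some.injEq] at h
    exact absurd h.1 (ne_seq_self _ _)
  · simp only [embed, Prod.mk.injEq, Option.some.injEq] at h
    exact absurd h.1.symm (ne_seq_self _ _)
  · simpa [embed] using h

theorem trans_embed (γ2 : Mech Ag V F R) {c c' : Cfg I} (h : Trans I c c') :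
    Trans I (embed I γ2 c) (embed I γ2 c') := by
  obtain ⟨_ | γ, s⟩ := c
  · exact absurd h not_trans_none
  · obtain ⟨L, h⟩ := h
    obtain ⟨_ | γ', s'⟩ := c'
    · exact ⟨L, .seqFin h⟩
    · exact ⟨L, .seqStep h⟩

theorem IsHist.map_embed (γ2 : Mech Ag V F R) {c0 : Cfg I} {H : List (Cfg I)}
    (h : IsHist I c0 H) : IsHist I (embed I γ2 c0) (H.map (embed I γ2)) := by
  rw [isHist_iff] at h ⊢
  refine ⟨by simp [h.1], ?_⟩
  exact List.isChain_map_of_isChain (embed I γ2) (fun _ _ => trans_embed γ2) h.2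

/-- Play `τ` while `γ1` is running, and `σ` afterwards. -/
def glue (I : Interp Ag V F R) (γ2 : Mech Ag V F R) (τ σ : Profile I) : Profile I :=
  fun a H => if h : ∃ g : List (Cfg I), H = g.map (embed I γ2) ∧ ∀ c ∈ g, c.1 ≠ none
    then τ a h.choose else σ a H

theorem glue_map (γ2 : Mech Ag V F R) (τ σ : Profile I) (a : Ag) {g : List (Cfg I)}
    (hg : ∀ c ∈ g, c.1 ≠ none) : glue I γ2 τ σ a (g.map (embed I γ2)) = τ a g := by
  have h : ∃ g' : List (Cfg I), g.map (embed I γ2) = g'.map (embed I γ2) ∧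
      ∀ c ∈ g', c.1 ≠ none := ⟨g, rfl, hg⟩
  rw [glue, dif_pos h]
  congr 1
  exact (List.map_injective_iff.2 (embed_injective γ2) h.choose_spec.1).symm

theorem glue_append (γ2 : Mech Ag V F R) (τ σ : Profile I) (a : Ag) (L G : List (Cfg I))
    (s : State I) :
    glue I γ2 τ σ a ((L ++ [(none, s)]).map (embed I γ2) ++ G) =
      σ a ((L ++ [(none, s)]).map (embed I γ2) ++ G) := by
  rw [glue, dif_neg]
  rintro ⟨g, hg, hn⟩
  obtain ⟨l1, l2, rfl, h1, -⟩ := List.append_eq_map_iff.1 hg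
  have := List.map_injective_iff.2 (embed_injective γ2) h1
  subst this
  exact hn (none, s) (by simp) rfl

theorem glue_restrict_self (γ2 : Mech Ag V F R) (σ : Profile I) :
    glue I γ2 (fun a g => σ a (g.map (embed I γ2))) σ = σ := by
  funext a H
  rw [glue]
  split_ifs with h
  · simp only [← h.choose_spec.1]
  · rfl

theorem glue_apply_eq (γ2 : Mech Ag V F R) (σ τ : Profile I) (j : Ag)
    (h : τ j = fun g => σ j (g.map (embed I γ2))) : glue I γ2 τ σ j = σ j := by
  have := congrFun (glue_restrict_self γ2 σ) j
  rw [← this]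
  funext H
  simp only [glue, h]

theorem runFrom_glue (γ2 : Mech Ag V F R) (τ σ : Profile I) (L : List (Cfg I)) (s : State I) :
    runFrom I (glue I γ2 τ σ) ((L ++ [(none, s)]).map (embed I γ2)) =
      runFrom I σ ((L ++ [(none, s)]).map (embed I γ2)) := by
  exact runFrom_congr fun a G => glue_append γ2 τ σ a L G s

theorem extend_glue (γ2 : Mech Ag V F R) (τ σ : Profile I) {c0 : Cfg I} {L : List (Cfg I)}
    {γ : Mech Ag V F R} {s : State I} (h : IsHist I c0 (L ++ [(some γ, s)])) :
    extend I (glue I γ2 τ σ) ((L ++ [(some γ, s)]).map (embed I γ2)) =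
      (extend I τ (L ++ [(some γ, s)])).map (embed I γ2) := by
  have hL : ∀ c ∈ L ++ [((some γ : Option (Mech Ag V F R)), s)], c.1 ≠ none := by
    intro c hc
    rcases List.mem_append.1 hc with hc | hc
    · exact isChain_dropLast_ne_none h.2 c hc
    · rw [List.mem_singleton.1 hc]; simp
  have hn := next_congr (σ := glue I γ2 τ σ) (τ := τ) (fun a => glue_map γ2 τ σ a hL) γ s
  rw [extend_snoc_some]
  simp only [List.map_append, List.map_cons, List.map_nil, embed]
  rw [extend_snoc_some]
  simp only [List.map_append, List.map_cons, List.map_nil, embed] at hn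
  simp only [next, hn]

theorem iterate_extend_glue (γ2 : Mech Ag V F R) (τ σ : Profile I) {c0 : Cfg I}
    {H : List (Cfg I)} (h : IsHist I c0 H) {n : ℕ}
    (hn : ∀ k < n, ¬ ∃ L s, (extend I τ)^[k] H = L ++ [(none, s)]) :
    (extend I (glue I γ2 τ σ))^[n] (H.map (embed I γ2)) =
      ((extend I τ)^[n] H).map (embed I γ2) := by
  induction n with
  | zero => rfl
  | succ n ih =>
    have h1 := h.iterate_extend τ n
    have h2 := hn n n.lt_succ_self
    rw [Function.iterate_succ_apply', ih fun k hk => hn k (hk.trans n.lt_succ_self),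
      Function.iterate_succ_apply']
    rcases List.eq_nil_or_concat' ((extend I τ)^[n] H) with h3 | ⟨L, ⟨_ | γ, s⟩, h3⟩
    · exact absurd h3 h1.ne_nil
    · exact absurd ⟨L, s, h3⟩ h2
    · rw [h3] at h1 ⊢
      exact extend_glue γ2 τ σ h1

/-- The outcome function on plays of `γ1` induced by `oh`, with `γ2` played according to `σ`. -/
def seqOutcome (I : Interp Ag V F R) (γ2 : Mech Ag V F R) (oh : OutcomeF I) (σ : Profile I) :
    OutcomeF I :=
  fun ρ => if h : ∃ H, ρ = listRun I H ∧ ∃ L s, H = L ++ [(none, s)]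
    then oh (runFrom I σ (h.choose.map (embed I γ2)))
    else oh fun n => (ρ n).map (embed I γ2)

theorem seqOutcome_listRun (γ2 : Mech Ag V F R) (oh : OutcomeF I) (σ : Profile I)
    (L : List (Cfg I)) (s : State I) :
    seqOutcome I γ2 oh σ (listRun I (L ++ [(none, s)])) =
      oh (runFrom I σ ((L ++ [(none, s)]).map (embed I γ2))) := by
  have h : ∃ H, listRun I (L ++ [(none, s)]) = listRun I H ∧ ∃ L s, H = L ++ [(none, s)] :=
    ⟨_, rfl, L, s, rfl⟩
  rw [seqOutcome, dif_pos h, ← listRun_injective h.choose_spec.1]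

theorem seqOutcome_runFrom (γ2 : Mech Ag V F R) (oh : OutcomeF I) (σ τ : Profile I)
    {c0 : Cfg I} {H : List (Cfg I)} (h : IsHist I c0 H) :
    seqOutcome I γ2 oh σ (runFrom I τ H) =
      oh (runFrom I (glue I γ2 τ σ) (H.map (embed I γ2))) := by
  by_cases hT : ∃ n L s, (extend I τ)^[n] H = L ++ [(none, s)]
  · obtain ⟨L, s, hL⟩ := Nat.find_spec hT
    have h1 := iterate_extend_glue γ2 τ σ h fun k hk => Nat.find_min hT hk
    rw [← runFrom_iterate τ h.ne_nil (Nat.find hT), hL, runFrom_none, seqOutcome_listRun,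
      ← runFrom_iterate (glue I γ2 τ σ) (h.map_embed γ2).ne_nil (Nat.find hT), h1, hL,
      runFrom_glue]
  · have hT' : ∀ n, ¬ ∃ L s, (extend I τ)^[n] H = L ++ [(none, s)] :=
      fun n hn => hT ⟨n, hn⟩
    rw [seqOutcome, dif_neg]
    · congr 1
      funext n
      simp only [runFrom, iterate_extend_glue γ2 τ σ h fun k _ => hT' k, List.getElem?_map]
    · rintro ⟨G, hG, -⟩
      have h1 := congrFun hG G.length
      simp only [runFrom, listRun, List.getElem?_eq_none le_rfl] at h1
      rcases lt_length_or_fixed τ h.ne_nil G.length with h2 | h2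
      · rw [List.getElem?_eq_getElem h2] at h1
        cases h1
      · rcases List.eq_nil_or_concat' ((extend I τ)^[G.length] H) with h3 | ⟨L, ⟨_ | γ, s⟩, h3⟩
        · exact iterate_extend_ne_nil τ h.ne_nil _ h3
        · exact hT' _ ⟨L, s, h3⟩
        · rw [h3, extend_snoc_some] at h2
          simp at h2

theorem wpre_seq_subset (γ1 γ2 : Mech Ag V F R) (Q : EPred I) :
    wpre I (.seq γ1 γ2) Q ⊆ wpre I γ1 (wpre I γ2 Q) := by
  rintro ⟨s, o⟩ hso
  rw [mem_wpre] at hso ⊢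
  obtain ⟨oh, σ, hQ, hσ, ho⟩ := hso
  refine ⟨seqOutcome I γ2 oh σ, fun a g => σ a (g.map (embed I γ2)), fun L s' hL => ?_,
    fun H hH i τ hτ => ?_, ?_⟩
  · rw [seqOutcome_listRun]
    have h1 := hL.map_embed γ2
    rw [List.map_append] at h1 ⊢
    exact mem_wpre_of_isHist hQ hσ h1
  · rw [seqOutcome_runFrom γ2 oh σ _ hH, seqOutcome_runFrom γ2 oh σ _ hH, glue_restrict_self]
    exact hσ _ (hH.map_embed γ2) i _ fun j hj => glue_apply_eq γ2 σ τ j (hτ j hj)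
  · rw [seqOutcome_runFrom γ2 oh σ _ (isHist_singleton _), glue_restrict_self]
    exact ho

/-- A transition taken regardless of the players' choices preserves weakest preconditions. -/
theorem mem_wpre_of_next {γ γ' : Mech Ag V F R} {Q : EPred I} {s s' : State I} {o : I.D}
    (hn : ∀ (σ : Profile I) (h : List (Cfg I)), next I σ h γ s = (some γ', s'))
    (h : (s, o) ∈ wpre I γ Q) : (s', o) ∈ wpre I γ' Q := by
  obtain ⟨oh, σ, hQ, hσ, ho⟩ := mem_wpre.1 h
  have h1 : extend I σ [(some γ, s)] = [(some γ, s)] ++ [(some γ', s')] := by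
    rw [← hn σ ([] ++ [(some γ, s)])]
    exact extend_snoc_some σ [] γ s
  rw [← ho, ← runFrom_extend σ (List.cons_ne_nil _ _), h1]
  refine mem_wpre_of_isHist hQ hσ ?_
  rw [← h1]
  exact (isHist_singleton _).extend σ

theorem mem_of_next {γ : Mech Ag V F R} {Q : EPred I} {s s' : State I} {o : I.D}
    (hn : ∀ (σ : Profile I) (h : List (Cfg I)), next I σ h γ s = (none, s'))
    (h : (s, o) ∈ wpre I γ Q) : (s', o) ∈ Q := by
  obtain ⟨oh, σ, hQ, hσ, ho⟩ := mem_wpre.1 h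
  have h1 : extend I σ [(some γ, s)] = [(some γ, s)] ++ [(none, s')] := by
    rw [← hn σ ([] ++ [(some γ, s)])]
    exact extend_snoc_some σ [] γ s
  rw [← ho, ← runFrom_extend σ (List.cons_ne_nil _ _), h1, runFrom_none]
  refine hQ _ _ ?_
  rw [← h1]
  exact (isHist_singleton _).extend σ

theorem deriv_wpre (γ : Mech Ag V F R) (Q : EPred I) : Deriv I (wpre I γ Q) γ Q := by
  induction γ generalizing Q with
  | assign x t =>
    refine .conseq ?_ (.assign Q x t) subset_rfl
    rintro ⟨s, o⟩ h
    show (updState I s x (t.eval I s), o) ∈ Q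
    exact mem_of_next (γ := .assign x t) (fun _ _ => rfl) h
  | seq γ1 γ2 ih1 ih2 =>
    exact .conseq (wpre_seq_subset γ1 γ2 Q) (.comp (ih1 _) (ih2 Q)) subset_rfl
  | ite B γ1 γ2 ih1 ih2 =>
    refine .ifR (.conseq ?_ (ih1 Q) subset_rfl) (.conseq ?_ (ih2 Q) subset_rfl)
    · rintro ⟨s, o⟩ ⟨h, hB⟩
      exact mem_wpre_of_next (γ := .ite B γ1 γ2) (fun _ _ => if_pos hB) h
    · rintro ⟨s, o⟩ ⟨h, hB⟩
      exact mem_wpre_of_next (γ := .ite B γ1 γ2) (fun _ _ => if_neg hB) h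
  | wh B γ ih =>
    refine .conseq subset_rfl (.whileR (.conseq ?_ (ih (wpre I (.wh B γ) Q)) subset_rfl)) ?_
    · rintro ⟨s, o⟩ ⟨h, hB⟩
      exact wpre_seq_subset _ _ _ (mem_wpre_of_next (γ := .wh B γ) (fun _ _ => if_pos hB) h)
    · rintro ⟨s, o⟩ ⟨h, hB⟩
      exact mem_of_next (γ := .wh B γ) (fun _ _ => if_neg hB) h
  | choice A hA X hX => exact .choice A hA X hX Q

end MPL

open MPL in
/-- Completeness: if `I ⊨ {P}γ{Q}` then `I ⊢ {P}γ{Q}` is derivable in the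
Hoare-style calculus for mechanisms. -/
theorem completeness {Ag V F R : Type} (I : Interp Ag V F R)
    (γ : Mech Ag V F R) (P Q : EPred I)
    (h : Valid I P γ Q) : Deriv I P γ Q := by
  exact .conseq h (deriv_wpre γ Q) subset_rfl
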